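/- Let (X, hgt) be a quasiparabolic W-set, let R = ℤ[q], and let T(X) be the free R-module with basis {T(x) : x ∈ X}. Fix ε ∈ {q, −1} and for s ∈ S define the R-linear endomorphism T_ε(s) of T(X) by: T_ε(s)T(x) = T(s·x) if hgt(s·x) > hgt(x); T_ε(s)T(x) = ε·T(x) if hgt(s·x) = hgt(x) (in which case s·x = x); and T_ε(s)T(x) = (q−1)T(x) + q·T(s·x) if hgt(s·x) < hgt(x). Then these operators satisfy the defining relations of the Hecke algebra of (W,S): the quadratic relation (T_ε(s) − q)(T_ε(s) + 1) = 0 for each s ∈ S, and for each pair s, t ∈ S with m(s,t) finite, the braid relation that the two alternating products T_ε(s)T_ε(t)T_ε(s)⋯ and T_ε(t)T_ε(s)T_ε(t)⋯, each with m(s,t) factors, are equal. -/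

import Mathlib

open CoxeterSystem

variable {B W : Type*} [Group W] {M : CoxeterMatrix B}

/-- A scaled `W`-set: heights change by at most 1 under simple reflections. -/
def IsScaled (cs : CoxeterSystem M W) {X : Type*} [MulAction W X] (hgt : X → ℤ) : Prop :=
  ∀ (b : B) (x : X), |hgt (cs.simple b • x) - hgt x| ≤ 1

/-- A quasiparabolic `W`-set: scaled, plus (QP1) and (QP2). -/
def IsQuasiparabolic (cs : CoxeterSystem M W) {X : Type*} [MulAction W X] (hgt : X → ℤ) : Prop :=
  IsScaled cs hgt ∧
  (∀ (r : W) (x : X), cs.IsReflection r → hgt (r • x) = hgt x → r • x = x) ∧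
  (∀ (r : W) (b : B) (x : X), cs.IsReflection r → hgt x < hgt (r • x) →
    hgt (cs.simple b • r • x) < hgt (cs.simple b • x) → r • x = cs.simple b • x)
/-- The operator `T_ε(s)` on the free `ℤ[q]`-module with basis a quasiparabolic
`W`-set, where `q = Polynomial.X` and `ε ∈ {q, −1}`. -/
noncomputable def heckeOp (cs : CoxeterSystem M W) {X : Type*} [MulAction W X]
    (hgt : X → ℤ) (ε : Polynomial ℤ) (b : B) :
    Module.End (Polynomial ℤ) (X →₀ Polynomial ℤ) :=
  Finsupp.lift (X →₀ Polynomial ℤ) (Polynomial ℤ) X fun x =>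
    if hgt x < hgt (cs.simple b • x) then Finsupp.single (cs.simple b • x) 1
    else if hgt (cs.simple b • x) = hgt x then Finsupp.single x ε
    else Finsupp.single x (Polynomial.X - 1) +
      Finsupp.single (cs.simple b • x) Polynomial.X

section AltProd

/-- The leftmost letter of the alternating word `⋯ a b a b` with `k + 1` letters. -/
def altLetter {α : Type*} (a b : α) (k : ℕ) : α := if Even k then b else a

theorem altLetter_succ {α : Type*} (a b : α) (k : ℕ) :
    altLetter a b (k + 1) = altLetter b a k := by
  unfold altLetter
  by_cases h : Even k <;> simp [h, Nat.even_add_one]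

theorem map_altLetter {α β : Type*} (f : α → β) (a b : α) (k : ℕ) :
    f (altLetter a b k) = altLetter (f a) (f b) k := apply_ite f _ _ _

/-- The alternating product `⋯ a b a b` with `k` factors, whose rightmost factor is `b`. -/
def altProd {G : Type*} [Monoid G] (a b : G) : ℕ → G
  | 0 => 1
  | k + 1 => altProd b a k * b

theorem prod_map_alternatingWord {α G : Type*} [Monoid G] (f : α → G) (a b : α) (k : ℕ) :
    ((alternatingWord a b k).map f).prod = altProd (f a) (f b) k := by
  induction k generalizing a b with
  | zero => simp [alternatingWord, altProd]
  | succ k ih => simp [alternatingWord, altProd, ih]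

variable {G : Type*}

theorem altProd_succ [Monoid G] (a b : G) (k : ℕ) :
    altProd a b (k + 1) = altProd b a k * b := rfl

theorem altProd_succ' [Monoid G] (a b : G) (k : ℕ) :
    altProd a b (k + 1) = altLetter a b k * altProd a b k := by
  induction k generalizing a b with
  | zero => simp [altProd, altLetter]
  | succ k ih => rw [altProd_succ, ih, altLetter_succ, altProd_succ, mul_assoc]

theorem altProd_add [Monoid G] (a b : G) (k n : ℕ) :
    altProd a b (k + n) = (if Even n then altProd a b k else altProd b a k) * altProd a b n := by
  induction n generalizing a b with
  | zero => simp [altProd]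
  | succ n ih =>
    rw [← add_assoc, altProd_succ, ih, altProd_succ, ← mul_assoc]
    by_cases h : Even n <;> simp [h, Nat.even_add_one]

theorem altProd_two_mul [Monoid G] (a b : G) (k : ℕ) : altProd a b (2 * k) = (a * b) ^ k := by
  induction k with
  | zero => simp [altProd]
  | succ k ih => rw [mul_add, mul_one, altProd_succ, altProd_succ, ih, mul_assoc, pow_succ]

theorem altProd_eq_altProd_mul_pow [Group G] {a b : G} (ha : a * a = 1) (hb : b * b = 1) (k : ℕ) :
    altProd a b k = altProd b a k * (a * b) ^ k := by
  induction k generalizing a b with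
  | zero => simp [altProd]
  | succ k ih =>
    have hpow : b * (a * b) ^ k = (b * a) ^ k * b := by
      clear ih
      induction k with
      | zero => simp
      | succ k ih => rw [pow_succ, ← mul_assoc, ih, pow_succ]; simp only [mul_assoc]
    rw [altProd_succ, altProd_succ, ih hb ha, pow_succ', mul_assoc, mul_assoc, ← mul_assoc a,
      ← mul_assoc a, ha, one_mul, hpow]

end AltProd

section Quadratic

variable {R V : Type*} [CommRing R] [AddCommGroup V] [Module R V] {q : R} {A D : Module.End R V}

theorem sub_smul_one_mul_add_one (hA : A * A = (q - 1) • A + q • 1) :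
    (A - q • 1) * (A + 1) = 0 := by
  rw [sub_mul, mul_add, mul_one, hA, smul_mul_assoc, one_mul, smul_add, sub_smul, one_smul]
  abel

theorem altProd_sub_altProd_mul (hA : A * A = (q - 1) • A + q • 1)
    (hD : D * D = (q - 1) • D + q • 1) (n : ℕ) :
    (altProd A D n - altProd D A n) * D =
      ((q - 1) • 1 - altLetter A D n) * (altProd A D n - altProd D A n) := by
  cases n with
  | zero => simp [altProd]
  | succ k =>
    have hsq : altLetter D A k * altLetter D A k = (q - 1) • altLetter D A k + q • 1 := by
      unfold altLetter
      split_ifs <;> assumption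
    have hl : altProd D A (k + 1) * D = altLetter D A k * altProd A D (k + 1) := by
      rw [← altProd_succ, altProd_succ', altLetter_succ]
    have hr : altProd A D (k + 1) * D = (q - 1) • altProd A D (k + 1) + q • altProd D A k := by
      rw [altProd_succ, mul_assoc, hD, mul_add, mul_smul_comm, mul_smul_comm, mul_one]
    have hc : altLetter D A k * altProd D A (k + 1) =
        (q - 1) • altProd D A (k + 1) + q • altProd D A k := by
      rw [altProd_succ', ← mul_assoc, hsq, add_mul, smul_mul_assoc, smul_mul_assoc, one_mul]
    rw [altLetter_succ, sub_mul, sub_mul, mul_sub, mul_sub, hl, hr, hc, smul_mul_assoc,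
      smul_mul_assoc, one_mul, one_mul]
    abel

theorem altProd_apply_eq_apply (hA : A * A = (q - 1) • A + q • 1)
    (hD : D * D = (q - 1) • D + q • 1) {n : ℕ} {v : V} (h : altProd A D n v = altProd D A n v) :
    altProd A D n (D v) = altProd D A n (D v) := by
  have h' := LinearMap.congr_fun (altProd_sub_altProd_mul hA hD n) v
  simp only [Module.End.mul_apply, LinearMap.sub_apply, h, sub_self, map_zero] at h'
  exact sub_eq_zero.1 h'

theorem altProd_apply_eq_altProd_apply (hA : A * A = (q - 1) • A + q • 1)
    (hD : D * D = (q - 1) • D + q • 1) {n : ℕ} (k : ℕ) {v : V}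
    (h : altProd A D n v = altProd D A n v) :
    altProd A D n (altProd A D k v) = altProd D A n (altProd A D k v) := by
  induction k generalizing A D v with
  | zero => simpa [altProd] using h
  | succ k ih =>
    exact (ih hD hA (altProd_apply_eq_apply hA hD h).symm).symm

theorem altProd_apply_eq_of_dvd (hA : A * A = (q - 1) • A + q • 1)
    (hD : D * D = (q - 1) • D + q • 1) {n m : ℕ} (hnm : n ∣ m) {v : V}
    (h : altProd A D n v = altProd D A n v) : altProd A D m v = altProd D A m v := by
  obtain ⟨j, rfl⟩ := hnm
  induction j generalizing v with
  | zero => simp [altProd]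
  | succ j ih =>
    have key := ih (altProd_apply_eq_altProd_apply hA hD n h)
    rw [mul_add, mul_one, altProd_add, altProd_add, Module.End.mul_apply, Module.End.mul_apply,
      ← h]
    split_ifs
    · exact key
    · exact key.symm

end Quadratic

section Heights

variable {X : Type*} [MulAction W X] {cs : CoxeterSystem M W} {hgt : X → ℤ}

theorem altProd_simple_succ_smul (s t : B) (k : ℕ) (x : X) :
    altProd (cs.simple t) (cs.simple s) (k + 1) • x =
      cs.simple (altLetter t s k) • altProd (cs.simple t) (cs.simple s) k • x := by
  rw [altProd_succ', map_altLetter cs.simple, mul_smul]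

theorem simple_smul_injective (s : B) {x y : X} (h : cs.simple s • x = cs.simple s • y) : x = y :=
  MulAction.injective (cs.simple s) h

theorem exists_isReflection_smul_altProd (cs : CoxeterSystem M W) (s t : B) (k : ℕ) (x : X) :
    ∃ r, cs.IsReflection r ∧ r • altProd (cs.simple s) (cs.simple t) k • x =
      altProd (cs.simple t) (cs.simple s) (k + 1) • x :=
  ⟨altProd (cs.simple s) (cs.simple t) k * cs.simple s *
    (altProd (cs.simple s) (cs.simple t) k)⁻¹, ⟨_, s, rfl⟩, by
      rw [altProd_succ, smul_smul, inv_mul_cancel_right]⟩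

theorem IsQuasiparabolic.hgt_altProd_add_two (hqp : IsQuasiparabolic cs hgt) {s t : B} {x : X}
    {i : ℕ} {c : ℤ} (hb : hgt (altProd (cs.simple s) (cs.simple t) i • x) = c)
    (hb' : hgt (altProd (cs.simple s) (cs.simple t) (i + 1) • x) = c + 1)
    (ha : hgt (altProd (cs.simple t) (cs.simple s) (i + 1) • x) = c + 1)
    (hne : altProd (cs.simple t) (cs.simple s) (i + 1) • x ≠
      altProd (cs.simple s) (cs.simple t) (i + 1) • x) :
    hgt (altProd (cs.simple t) (cs.simple s) (i + 2) • x) = c + 2 := by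
  obtain ⟨hsc, hq1, hq2⟩ := hqp
  have ea : altProd (cs.simple t) (cs.simple s) (i + 2) • x = _ :=
    altProd_simple_succ_smul (cs := cs) s t (i + 1) x
  have eb := altProd_simple_succ_smul (cs := cs) t s i x
  rw [altLetter_succ] at ea
  have hd := abs_le.1 (hsc (altLetter s t i) (altProd (cs.simple t) (cs.simple s) (i + 1) • x))
  rw [← ea] at hd
  by_contra hcon
  rcases lt_or_eq_of_le
      (show hgt (altProd (cs.simple t) (cs.simple s) (i + 2) • x) ≤ c + 1 by omega) with h | h
  · obtain ⟨r, hr, hrx⟩ := exists_isReflection_smul_altProd cs s t i x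
    have := hq2 r (altLetter s t i) _ hr (by rw [hrx]; omega) (by rw [hrx, ← ea, ← eb]; omega)
    exact hne (by rw [← hrx, this, ← eb])
  · obtain ⟨r, hr, hrx⟩ := exists_isReflection_smul_altProd cs s t (i + 1) x
    have := hq1 r _ hr (by rw [hrx, h, hb'])
    rw [hrx, ea, eb] at this
    have := simple_smul_injective _ this
    rw [this] at ha
    omega

theorem IsQuasiparabolic.hgt_altProd_of_lt (hqp : IsQuasiparabolic cs hgt) {s t : B} {x : X} {n : ℕ}
    (hne : ∀ j, 0 < j → j < n → altProd (cs.simple t) (cs.simple s) j • x ≠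
      altProd (cs.simple s) (cs.simple t) j • x)
    (hs : hgt x < hgt (cs.simple s • x)) (ht : hgt x < hgt (cs.simple t • x)) {j : ℕ}
    (hj : j ≤ n) :
    hgt (altProd (cs.simple t) (cs.simple s) j • x) = hgt x + j ∧
      hgt (altProd (cs.simple s) (cs.simple t) j • x) = hgt x + j := by
  induction j using Nat.strong_induction_on with
  | _ j ih =>
    match j with
    | 0 => simp [altProd]
    | 1 =>
      have h1 := abs_le.1 (hqp.1 s x)
      have h2 := abs_le.1 (hqp.1 t x)
      simp only [altProd, one_mul, Nat.cast_one]
      omega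
    | i + 2 =>
      obtain ⟨ha, hb⟩ := ih i (by omega) (by omega)
      obtain ⟨ha', hb'⟩ := ih (i + 1) (by omega) (by omega)
      push_cast at ha' hb' ⊢
      rw [← add_assoc] at ha' hb'
      have h := hne (i + 1) (by omega) (by omega)
      rw [← add_assoc]
      exact ⟨hqp.hgt_altProd_add_two hb hb' ha' h, hqp.hgt_altProd_add_two ha ha' hb' h.symm⟩

theorem IsQuasiparabolic.hgt_altProd_of_fixed (hqp : IsQuasiparabolic cs hgt) {s t : B} {x : X}
    {n : ℕ} (hne : ∀ j, 0 < j → j < n → altProd (cs.simple t) (cs.simple s) j • x ≠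
      altProd (cs.simple s) (cs.simple t) j • x)
    (hs : cs.simple s • x = x) (ht : hgt x ≤ hgt (cs.simple t • x)) {j : ℕ} (hj : j < n) :
    hgt (altProd (cs.simple s) (cs.simple t) j • x) = hgt x + j := by
  have hshift : ∀ k, altProd (cs.simple t) (cs.simple s) (k + 1) • x =
      altProd (cs.simple s) (cs.simple t) k • x := fun k => by
    rw [altProd_succ, mul_smul, hs]
  induction j using Nat.strong_induction_on with
  | _ j ih =>
    match j with
    | 0 => simp [altProd]
    | k + 1 =>
      have hk := ih k (by omega) (by omega)
      have hstep := altProd_simple_succ_smul (cs := cs) t s k x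
      have hd := abs_le.1 (hqp.1 (altLetter s t k) (altProd (cs.simple s) (cs.simple t) k • x))
      rw [← hstep] at hd
      have hneq : hgt (altProd (cs.simple s) (cs.simple t) (k + 1) • x) ≠
          hgt (altProd (cs.simple s) (cs.simple t) k • x) := fun h => by
        have := hqp.2.1 _ _ (cs.isReflection_simple (altLetter s t k)) (by rw [← hstep, h])
        exact hne (k + 1) (by omega) hj (by rw [hshift, hstep, this])
      suffices hgt (altProd (cs.simple s) (cs.simple t) k • x) ≤
          hgt (altProd (cs.simple s) (cs.simple t) (k + 1) • x) by
        push_cast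
        omega
      match k with
      | 0 => simpa [altProd] using ht
      | i + 1 =>
        by_contra hlt
        have hi := ih i (by omega) (by omega)
        obtain ⟨r, hr, hrx⟩ := exists_isReflection_smul_altProd cs t s (i + 1) x
        have heq := hqp.2.1 r _ hr (by rw [hrx, hshift]; push_cast at hk; omega)
        rw [hrx, hstep, altProd_simple_succ_smul s t i, altLetter_succ] at heq
        have heq := congrArg hgt (simple_smul_injective _ heq)
        rw [hk] at heq
        match i with
        | 0 => simp [altProd] at heq
        | l + 1 =>
          rw [hshift, ih l (by omega) (by omega)] at heq
          push_cast at heq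
          omega

end Heights

section HeckeOp

variable {X : Type*} [MulAction W X] {cs : CoxeterSystem M W} {hgt : X → ℤ} {ε : Polynomial ℤ}

theorem heckeOp_single_one (b : B) (x : X) :
    heckeOp cs hgt ε b (Finsupp.single x 1) =
      if hgt x < hgt (cs.simple b • x) then Finsupp.single (cs.simple b • x) 1
      else if hgt (cs.simple b • x) = hgt x then Finsupp.single x ε
      else Finsupp.single x (Polynomial.X - 1) +
        Finsupp.single (cs.simple b • x) Polynomial.X := by
  rw [heckeOp, Finsupp.lift_apply, Finsupp.sum_single_index, one_smul]
  rw [zero_smul]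

theorem heckeOp_single_of_lt {b : B} {x : X} (h : hgt x < hgt (cs.simple b • x)) :
    heckeOp cs hgt ε b (Finsupp.single x 1) = Finsupp.single (cs.simple b • x) 1 := by
  rw [heckeOp_single_one, if_pos h]

theorem heckeOp_single_of_fixed {b : B} {x : X} (h : cs.simple b • x = x) :
    heckeOp cs hgt ε b (Finsupp.single x 1) = ε • Finsupp.single x 1 := by
  rw [heckeOp_single_one, h, if_neg (lt_irrefl _), if_pos rfl, Finsupp.smul_single_one]

theorem heckeOp_single_of_gt {b : B} {x : X} (h : hgt (cs.simple b • x) < hgt x) :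
    heckeOp cs hgt ε b (Finsupp.single x 1) =
      (Polynomial.X - 1 : Polynomial ℤ) • Finsupp.single x 1 +
        (Polynomial.X : Polynomial ℤ) • Finsupp.single (cs.simple b • x) 1 := by
  rw [heckeOp_single_one, if_neg h.not_gt, if_neg h.ne, Finsupp.smul_single_one,
    Finsupp.smul_single_one]

theorem IsQuasiparabolic.heckeOp_mul_self (hqp : IsQuasiparabolic cs hgt)
    (hε : ε = Polynomial.X ∨ ε = -1) (b : B) :
    heckeOp cs hgt ε b * heckeOp cs hgt ε b =
      (Polynomial.X - 1 : Polynomial ℤ) • heckeOp cs hgt ε b + (Polynomial.X : Polynomial ℤ) • 1 := by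
  refine Finsupp.lhom_ext' fun x => LinearMap.ext_ring ?_
  simp only [LinearMap.comp_apply, Finsupp.lsingle_apply, Module.End.mul_apply,
    LinearMap.add_apply, LinearMap.smul_apply, Module.End.one_apply]
  have hinv : cs.simple b • cs.simple b • x = x := by
    rw [smul_smul, cs.simple_mul_simple_self, one_smul]
  rcases lt_trichotomy (hgt x) (hgt (cs.simple b • x)) with h | h | h
  · rw [heckeOp_single_of_lt h, heckeOp_single_of_gt (by rwa [hinv]), hinv]
  · have hfix := hqp.2.1 _ _ (cs.isReflection_simple b) h.symm
    rw [heckeOp_single_of_fixed hfix, map_smul, heckeOp_single_of_fixed hfix, smul_smul, smul_smul,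
      ← add_smul]
    rcases hε with rfl | rfl <;> congr 1 <;> ring
  · rw [heckeOp_single_of_gt h, map_add, map_smul, map_smul, heckeOp_single_of_gt h,
      heckeOp_single_of_lt (by rwa [hinv]), hinv]

theorem altProd_heckeOp_single {s t : B} {x : X} {n : ℕ}
    (h : ∀ j ≤ n, hgt (altProd (cs.simple t) (cs.simple s) j • x) = hgt x + j) :
    altProd (heckeOp cs hgt ε t) (heckeOp cs hgt ε s) n (Finsupp.single x 1) =
      Finsupp.single (altProd (cs.simple t) (cs.simple s) n • x) 1 := by
  induction n with
  | zero => simp [altProd]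
  | succ n ih =>
    have h1 := h n (by omega)
    have h2 := h (n + 1) le_rfl
    rw [altProd_simple_succ_smul] at h2 ⊢
    rw [altProd_succ', Module.End.mul_apply, ih fun j hj => h j (by omega),
      ← map_altLetter (heckeOp cs hgt ε), heckeOp_single_of_lt]
    push_cast at h2
    omega

theorem IsQuasiparabolic.altProd_heckeOp_single_of_fixed (hqp : IsQuasiparabolic cs hgt)
    {s t : B} {x : X} {n : ℕ} (hn : 0 < n)
    (hne : ∀ j, 0 < j → j < n → altProd (cs.simple t) (cs.simple s) j • x ≠
      altProd (cs.simple s) (cs.simple t) j • x)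
    (heq : altProd (cs.simple t) (cs.simple s) n • x = altProd (cs.simple s) (cs.simple t) n • x)
    (hs : cs.simple s • x = x) (ht : hgt x ≤ hgt (cs.simple t • x)) :
    altProd (heckeOp cs hgt ε t) (heckeOp cs hgt ε s) n (Finsupp.single x 1) =
      altProd (heckeOp cs hgt ε s) (heckeOp cs hgt ε t) n (Finsupp.single x 1) := by
  obtain ⟨k, rfl⟩ := Nat.exists_eq_succ_of_ne_zero hn.ne'
  have hup := altProd_heckeOp_single (ε := ε) (n := k) fun j hj =>
    hqp.hgt_altProd_of_fixed hne hs ht (by omega : j < k + 1)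
  have hfix : cs.simple (altLetter s t k) • altProd (cs.simple s) (cs.simple t) k • x =
      altProd (cs.simple s) (cs.simple t) k • x := by
    rw [← altProd_simple_succ_smul, ← heq, altProd_succ, mul_smul, hs]
  rw [Nat.succ_eq_add_one, altProd_succ, altProd_succ' (heckeOp cs hgt ε s),
    Module.End.mul_apply, Module.End.mul_apply, heckeOp_single_of_fixed hs, map_smul, hup,
    ← map_altLetter (heckeOp cs hgt ε), heckeOp_single_of_fixed hfix]

theorem altProd_simple_smul_eq_iff (s t : B) (x : X) (k : ℕ) :
    altProd (cs.simple t) (cs.simple s) k • x = altProd (cs.simple s) (cs.simple t) k • x ↔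
      (cs.simple t * cs.simple s) ^ k • x = x := by
  rw [altProd_eq_altProd_mul_pow (cs.simple_mul_simple_self t) (cs.simple_mul_simple_self s),
    mul_smul, smul_left_cancel_iff]

/-- The braid relation at a basis element whose height is minimal among its neighbours. -/
theorem IsQuasiparabolic.altProd_heckeOp_single_of_le (hqp : IsQuasiparabolic cs hgt)
    (hε : ε = Polynomial.X ∨ ε = -1) {s t : B} (hst : M s t ≠ 0) {x : X}
    (hs : hgt x ≤ hgt (cs.simple s • x)) (ht : hgt x ≤ hgt (cs.simple t • x)) :
    altProd (heckeOp cs hgt ε t) (heckeOp cs hgt ε s) (M s t) (Finsupp.single x 1) =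
      altProd (heckeOp cs hgt ε s) (heckeOp cs hgt ε t) (M s t) (Finsupp.single x 1) := by
  set w := cs.simple t * cs.simple s
  have hper : w ^ M s t • x = x := by rw [cs.simple_mul_simple_pow', one_smul]
  have hdvd : MulAction.period w x ∣ M s t := MulAction.pow_smul_eq_iff_period_dvd.1 hper
  have hpos : 0 < MulAction.period w x := Nat.pos_of_dvd_of_pos hdvd (Nat.pos_of_ne_zero hst)
  have heq := (altProd_simple_smul_eq_iff (cs := cs) s t x (MulAction.period w x)).2
    (MulAction.pow_period_smul w x)
  have hne : ∀ j, 0 < j → j < MulAction.period w x →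
      altProd (cs.simple t) (cs.simple s) j • x ≠ altProd (cs.simple s) (cs.simple t) j • x :=
    fun j hj hlt h => hlt.not_ge <| Nat.le_of_dvd hj <|
      MulAction.pow_smul_eq_iff_period_dvd.1 ((altProd_simple_smul_eq_iff s t x j).1 h)
  refine altProd_apply_eq_of_dvd (hqp.heckeOp_mul_self hε t) (hqp.heckeOp_mul_self hε s) hdvd ?_
  have hfix : ∀ b, hgt x = hgt (cs.simple b • x) → cs.simple b • x = x := fun b h =>
    hqp.2.1 _ _ (cs.isReflection_simple b) h.symm
  rcases hs.lt_or_eq with hs' | hs'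
  · rcases ht.lt_or_eq with ht' | ht'
    · rw [altProd_heckeOp_single fun j hj => (hqp.hgt_altProd_of_lt hne hs' ht' hj).1,
        altProd_heckeOp_single fun j hj => (hqp.hgt_altProd_of_lt hne hs' ht' hj).2, heq]
    · exact (hqp.altProd_heckeOp_single_of_fixed hpos (fun j h h' => (hne j h h').symm) heq.symm
        (hfix t ht') hs).symm
  · exact hqp.altProd_heckeOp_single_of_fixed hpos hne heq (hfix s hs') ht

theorem IsQuasiparabolic.altProd_heckeOp_single_of_gt (hqp : IsQuasiparabolic cs hgt)
    (hε : ε = Polynomial.X ∨ ε = -1) {s t : B} {n : ℕ} {x : X}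
    (hs : hgt (cs.simple s • x) < hgt x)
    (h : altProd (heckeOp cs hgt ε t) (heckeOp cs hgt ε s) n (Finsupp.single (cs.simple s • x) 1) =
      altProd (heckeOp cs hgt ε s) (heckeOp cs hgt ε t) n (Finsupp.single (cs.simple s • x) 1)) :
    altProd (heckeOp cs hgt ε t) (heckeOp cs hgt ε s) n (Finsupp.single x 1) =
      altProd (heckeOp cs hgt ε s) (heckeOp cs hgt ε t) n (Finsupp.single x 1) := by
  have hinv : cs.simple s • cs.simple s • x = x := by
    rw [smul_smul, cs.simple_mul_simple_self, one_smul]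
  have hx : heckeOp cs hgt ε s (Finsupp.single (cs.simple s • x) 1) = Finsupp.single x 1 := by
    rw [heckeOp_single_of_lt (by rwa [hinv]), hinv]
  rw [← hx]
  exact altProd_apply_eq_apply (hqp.heckeOp_mul_self hε t) (hqp.heckeOp_mul_self hε s) h

theorem exists_hgt_altProd_le_succ {s t : B} (hst : M s t ≠ 0) (x : X) :
    ∃ j, hgt (altProd (cs.simple t) (cs.simple s) j • x) ≤
      hgt (altProd (cs.simple t) (cs.simple s) (j + 1) • x) := by
  by_contra! hcon
  have := strictAnti_nat_of_succ_lt
    (f := fun j => hgt (altProd (cs.simple t) (cs.simple s) j • x)) hcon (by omega : 0 < 2 * M s t)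
  simp only [altProd_two_mul, cs.simple_mul_simple_pow'] at this
  simp [altProd] at this

/-- The braid relation at a basis element whose height is not lowered by `t`. -/
theorem IsQuasiparabolic.altProd_heckeOp_single_of_le_right (hqp : IsQuasiparabolic cs hgt)
    (hε : ε = Polynomial.X ∨ ε = -1) {s t : B} (hst : M s t ≠ 0) {x : X}
    (ht : hgt x ≤ hgt (cs.simple t • x)) :
    altProd (heckeOp cs hgt ε t) (heckeOp cs hgt ε s) (M s t) (Finsupp.single x 1) =
      altProd (heckeOp cs hgt ε s) (heckeOp cs hgt ε t) (M s t) (Finsupp.single x 1) := by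
  obtain ⟨j, hj⟩ := exists_hgt_altProd_le_succ (cs := cs) (hgt := hgt) hst x
  induction j generalizing s t x with
  | zero =>
    simp only [altProd, one_smul, one_mul] at hj
    exact hqp.altProd_heckeOp_single_of_le hε hst hj ht
  | succ j ih =>
    rcases le_or_gt (hgt x) (hgt (cs.simple s • x)) with hs | hs
    · exact hqp.altProd_heckeOp_single_of_le hε hst hs ht
    · refine hqp.altProd_heckeOp_single_of_gt hε hs ?_
      rw [altProd_succ, altProd_succ _ _ (j + 1), mul_smul, mul_smul] at hj
      have hsymm : M s t = M t s := M.symmetric s t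
      rw [hsymm] at hst ⊢
      refine (ih hst ?_ hj).symm
      rw [smul_smul, cs.simple_mul_simple_self, one_smul]
      exact hs.le

theorem IsQuasiparabolic.altProd_heckeOp (hqp : IsQuasiparabolic cs hgt)
    (hε : ε = Polynomial.X ∨ ε = -1) {s t : B} (hst : M s t ≠ 0) :
    altProd (heckeOp cs hgt ε s) (heckeOp cs hgt ε t) (M s t) =
      altProd (heckeOp cs hgt ε t) (heckeOp cs hgt ε s) (M s t) := by
  refine Finsupp.lhom_ext' fun x => LinearMap.ext_ring ?_
  rcases le_or_gt (hgt x) (hgt (cs.simple t • x)) with ht | ht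
  · exact (hqp.altProd_heckeOp_single_of_le_right hε hst ht).symm
  · refine hqp.altProd_heckeOp_single_of_gt hε ht
      (hqp.altProd_heckeOp_single_of_le_right hε hst ?_).symm
    rw [smul_smul, cs.simple_mul_simple_self, one_smul]
    exact ht.le

end HeckeOp

/-- the operators `T_ε(s)` on the free module over a quasiparabolic
`W`-set satisfy the quadratic relations `(T(s) − q)(T(s) + 1) = 0` and the braid
relations of the Hecke algebra of `(W, S)`. -/
theorem heckeOp_relations (cs : CoxeterSystem M W) {X : Type*} [MulAction W X]
    (hgt : X → ℤ) (hqp : IsQuasiparabolic cs hgt)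
    (ε : Polynomial ℤ) (hε : ε = Polynomial.X ∨ ε = -1) :
    (∀ b : B,
      (heckeOp cs hgt ε b - (Polynomial.X : Polynomial ℤ) • 1) * (heckeOp cs hgt ε b + 1) = 0) ∧
    (∀ b b' : B, M b b' ≠ 0 →
      ((alternatingWord b b' (M b b')).map (heckeOp cs hgt ε)).prod =
        ((alternatingWord b' b (M b b')).map (heckeOp cs hgt ε)).prod) := by
  refine ⟨fun b => ?_, fun b b' h => ?_⟩
  · exact sub_smul_one_mul_add_one (hqp.heckeOp_mul_self hε b)
  · rw [prod_map_alternatingWord, prod_map_alternatingWord, hqp.altProd_heckeOp hε h]
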